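/- For all integers m ≥ 1 and b ≥ 1, ker(∇ : M_D^{(m,b)} → M_D^{(m−1,b+1)}) = ∇(M_D^{(m+1,b−1)}); that is, the complexes of finite Verma modules of quadrant D over 𝒜(K′₄) are exact at every interior point of the quadrant. -/

import Mathlib

/- Setup: `Cl` is the Clifford algebra over `ℂ[Θ]` realizing `U(𝔤₍<₀₎)` for
`𝒜(K′₄)`, with `w11, w22, w12, w21` as in the paper.  On `Cl ⊗[ℂ] ℂ[x₁,x₂,v₁,v₂]`
(variables `X 0, X 1 = x₁, x₂` and `X 2, X 3 = v₁, v₂`) we define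
`∇(u ⊗ p) = u·w₁₁ ⊗ v₁∂ₓ₁p + u·w₂₁ ⊗ v₁∂ₓ₂p + u·w₁₂ ⊗ v₂∂ₓ₁p + u·w₂₂ ⊗ v₂∂ₓ₂p`,
and `MD m b = Cl ⊗ (bihomogeneous polynomials of degree m in x and b in v)` is the
finite Verma module `M(m,b,1+(b−m)/2,1+(m+b)/2)` of quadrant D. -/

set_option synthInstance.maxHeartbeats 1000000
set_option maxHeartbeats 1000000

noncomputable section

open scoped TensorProduct

def Qf : QuadraticForm (Polynomial ℂ) (Fin 4 → Polynomial ℂ) :=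
  QuadraticMap.weightedSumSquares (Polynomial ℂ) (fun _ : Fin 4 => (Polynomial.X : Polynomial ℂ))

abbrev Cl : Type := CliffordAlgebra Qf

def η (i : Fin 4) : Cl := CliffordAlgebra.ι Qf (Pi.single i 1)

def ii : Cl := algebraMap ℂ Cl Complex.I

def w11 : Cl := η 1 + ii * η 0
def w22 : Cl := η 1 - ii * η 0
def w12 : Cl := -(η 3) + ii * η 2
def w21 : Cl := η 3 + ii * η 2

abbrev P4 : Type := MvPolynomial (Fin 4) ℂ

abbrev MCl : Type := Cl ⊗[ℂ] P4

instance : AddCommGroup MCl := inferInstance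
instance : Module ℂ MCl := inferInstance

def pd (i : Fin 4) : P4 →ₗ[ℂ] P4 := (MvPolynomial.pderiv i).toLinearMap

/-- `∇(u ⊗ p) = u·w₁₁ ⊗ v₁∂ₓ₁p + u·w₂₁ ⊗ v₁∂ₓ₂p + u·w₁₂ ⊗ v₂∂ₓ₁p + u·w₂₂ ⊗ v₂∂ₓ₂p` -/
def nablaD : MCl →ₗ[ℂ] MCl :=
  TensorProduct.map (LinearMap.mulRight ℂ w11) (LinearMap.mulLeft ℂ (MvPolynomial.X 2 : P4) ∘ₗ pd 0) +
  TensorProduct.map (LinearMap.mulRight ℂ w21) (LinearMap.mulLeft ℂ (MvPolynomial.X 2 : P4) ∘ₗ pd 1) +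
  TensorProduct.map (LinearMap.mulRight ℂ w12) (LinearMap.mulLeft ℂ (MvPolynomial.X 3 : P4) ∘ₗ pd 0) +
  TensorProduct.map (LinearMap.mulRight ℂ w22) (LinearMap.mulLeft ℂ (MvPolynomial.X 3 : P4) ∘ₗ pd 1)

/-- weight of the `x`-variables -/
def wx : Fin 4 → ℕ := ![1, 1, 0, 0]
/-- weight of the `v`-variables -/
def wv : Fin 4 → ℕ := ![0, 0, 1, 1]

/-- The Verma module `M_D^{(m,b)}`: the span of the `u ⊗ p` with `p` bihomogeneous of
degree `m` in `x₁,x₂` and degree `b` in `v₁,v₂`. -/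
def MD (m b : ℕ) : Submodule ℂ MCl :=
  Submodule.span ℂ {z | ∃ (u : Cl) (p : P4),
    MvPolynomial.IsWeightedHomogeneous wx p m ∧ MvPolynomial.IsWeightedHomogeneous wv p b ∧
    z = u ⊗ₜ p}

set_option linter.all false

structure CAR {V : Type*} [AddCommGroup V] [Module ℂ V]
    (r1 r2 d1 d2 x1 x2 p1 p2 : V →ₗ[ℂ] V) (G : ℕ → Submodule ℂ V) : Prop where
  r11 : ∀ z, r1 (r1 z) = 0
  r22 : ∀ z, r2 (r2 z) = 0
  r21 : ∀ z, r2 (r1 z) = - r1 (r2 z)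
  d11 : ∀ z, d1 (d1 z) = 0
  d22 : ∀ z, d2 (d2 z) = 0
  d21 : ∀ z, d2 (d1 z) = - d1 (d2 z)
  dr11 : ∀ z, d1 (r1 z) = z - r1 (d1 z)
  dr12 : ∀ z, d1 (r2 z) = - r2 (d1 z)
  dr21 : ∀ z, d2 (r1 z) = - r1 (d2 z)
  dr22 : ∀ z, d2 (r2 z) = z - r2 (d2 z)
  px11 : ∀ z, p1 (x1 z) = z + x1 (p1 z)
  px12 : ∀ z, p1 (x2 z) = x2 (p1 z)
  px21 : ∀ z, p2 (x1 z) = x1 (p2 z)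
  px22 : ∀ z, p2 (x2 z) = z + x2 (p2 z)
  p21 : ∀ z, p2 (p1 z) = p1 (p2 z)
  rx11 : ∀ z, r1 (x1 z) = x1 (r1 z)
  rx12 : ∀ z, r1 (x2 z) = x2 (r1 z)
  rx21 : ∀ z, r2 (x1 z) = x1 (r2 z)
  rx22 : ∀ z, r2 (x2 z) = x2 (r2 z)
  dx11 : ∀ z, d1 (x1 z) = x1 (d1 z)
  dx12 : ∀ z, d1 (x2 z) = x2 (d1 z)
  dx21 : ∀ z, d2 (x1 z) = x1 (d2 z)
  dx22 : ∀ z, d2 (x2 z) = x2 (d2 z)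
  rp11 : ∀ z, r1 (p1 z) = p1 (r1 z)
  rp12 : ∀ z, r1 (p2 z) = p2 (r1 z)
  rp21 : ∀ z, r2 (p1 z) = p1 (r2 z)
  rp22 : ∀ z, r2 (p2 z) = p2 (r2 z)
  dp11 : ∀ z, d1 (p1 z) = p1 (d1 z)
  dp12 : ∀ z, d1 (p2 z) = p2 (d1 z)
  dp21 : ∀ z, d2 (p1 z) = p1 (d2 z)
  dp22 : ∀ z, d2 (p2 z) = p2 (d2 z)
  euler : ∀ m, ∀ z ∈ G m, x1 (p1 z) + x2 (p2 z) = (m : ℂ) • z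
  Gr1 : ∀ m, ∀ z ∈ G m, r1 z ∈ G m
  Gr2 : ∀ m, ∀ z ∈ G m, r2 z ∈ G m
  Gd1 : ∀ m, ∀ z ∈ G m, d1 z ∈ G m
  Gd2 : ∀ m, ∀ z ∈ G m, d2 z ∈ G m
  Gx1 : ∀ m, ∀ z ∈ G m, x1 z ∈ G (m + 1)
  Gx2 : ∀ m, ∀ z ∈ G m, x2 z ∈ G (m + 1)
  Gp1 : ∀ m, ∀ z ∈ G (m + 1), p1 z ∈ G m
  Gp2 : ∀ m, ∀ z ∈ G (m + 1), p2 z ∈ G m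

section abstractPart
variable {V : Type*} [AddCommGroup V] [Module ℂ V]
  {r1 r2 d1 d2 x1 x2 p1 p2 : V →ₗ[ℂ] V} {G : ℕ → Submodule ℂ V}

/-- `A = r1 p1 + r2 p2` -/
def opA (r1 r2 p1 p2 : V →ₗ[ℂ] V) : V →ₗ[ℂ] V := r1 ∘ₗ p1 + r2 ∘ₗ p2

theorem opA_apply (z : V) : opA r1 r2 p1 p2 z = r1 (p1 z) + r2 (p2 z) := rfl

theorem CAR.AB (h : CAR r1 r2 d1 d2 x1 x2 p1 p2 G) {m : ℕ} {u : V} (hu : u ∈ G m)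
    (hA : opA r1 r2 p1 p2 u = 0) :
    opA r1 r2 p1 p2 (x1 (d1 u) + x2 (d2 u)) = (m : ℂ) • u + (r1 (d1 u) + r2 (d2 u)) := by
  have key : opA r1 r2 p1 p2 (x1 (d1 u) + x2 (d2 u))
      + (x1 (d1 (opA r1 r2 p1 p2 u)) + x2 (d2 (opA r1 r2 p1 p2 u)))
      = (x1 (p1 u) + x2 (p2 u)) + (r1 (d1 u) + r2 (d2 u)) := by
    simp only [opA_apply, map_add, map_sub, map_neg, h.px11, h.px12, h.px21, h.px22,
      h.rx11, h.rx12, h.rx21, h.rx22, h.dx11, h.dx12, h.dx21, h.dx22, h.rp11, h.rp12, h.rp21,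
      h.rp22, h.dp11, h.dp12, h.dp21, h.dp22, h.dr11, h.dr12, h.dr21, h.dr22]
    abel
  rw [hA] at key
  simpa [h.euler m u hu] using key

theorem CAR.mem_B (h : CAR r1 r2 d1 d2 x1 x2 p1 p2 G) {m : ℕ} {u : V} (hu : u ∈ G m) :
    x1 (d1 u) + x2 (d2 u) ∈ G (m + 1) :=
  add_mem (h.Gx1 _ _ (h.Gd1 _ _ hu)) (h.Gx2 _ _ (h.Gd2 _ _ hu))

theorem CAR.mem_N (h : CAR r1 r2 d1 d2 x1 x2 p1 p2 G) {m : ℕ} {u : V} (hu : u ∈ G m) :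
    r1 (d1 u) + r2 (d2 u) ∈ G m :=
  add_mem (h.Gr1 _ _ (h.Gd1 _ _ hu)) (h.Gr2 _ _ (h.Gd2 _ _ hu))

theorem CAR.mem_A (h : CAR r1 r2 d1 d2 x1 x2 p1 p2 G) {m : ℕ} {u : V} (hu : u ∈ G (m + 1)) :
    opA r1 r2 p1 p2 u ∈ G m :=
  add_mem (h.Gr1 _ _ (h.Gp1 _ _ hu)) (h.Gr2 _ _ (h.Gp2 _ _ hu))

theorem CAR.AN (h : CAR r1 r2 d1 d2 x1 x2 p1 p2 G) {u : V}
    (hA : opA r1 r2 p1 p2 u = 0) :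
    opA r1 r2 p1 p2 (r1 (d1 u) + r2 (d2 u)) = 0 := by
  have key : opA r1 r2 p1 p2 (r1 (d1 u) + r2 (d2 u))
     = r1 (d1 (opA r1 r2 p1 p2 u)) + r2 (d2 (opA r1 r2 p1 p2 u)) - opA r1 r2 p1 p2 u := by
    simp only [opA_apply, map_add, map_sub, map_neg,
      h.rp11, h.rp12, h.rp21,
      h.rp22, h.dp11, h.dp12, h.dp21, h.dp22, h.dr11, h.dr12, h.dr21, h.dr22,
      h.r11, h.r22, h.r21, map_zero]
    abel
  rw [key, hA]; simp

theorem CAR.level0 (h : CAR r1 r2 d1 d2 x1 x2 p1 p2 G) {m : ℕ} (hm : 1 ≤ m) {u : V}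
    (hu : u ∈ G m) (hA : opA r1 r2 p1 p2 u = 0) (h1 : d1 u = 0) (h2 : d2 u = 0) : u = 0 := by
  have := h.AB hu hA
  rw [h1, h2] at this
  simp only [map_zero, add_zero] at this
  rcases smul_eq_zero.1 this.symm with h3 | h3
  · have : m = 0 := by exact_mod_cast h3
    omega
  · exact h3

theorem CAR.level1 (h : CAR r1 r2 d1 d2 x1 x2 p1 p2 G) {m : ℕ} (hm : 1 ≤ m) {u : V}
    (hu : u ∈ G m) (hA : opA r1 r2 p1 p2 u = 0) (h12 : d1 (d2 u) = 0) :
    r1 (d1 u) + r2 (d2 u) = u ∧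
    opA r1 r2 p1 p2 (x1 (d1 u) + x2 (d2 u)) = ((m : ℂ) + 1) • u ∧
    d1 (x1 (d1 u) + x2 (d2 u)) = 0 ∧ d2 (x1 (d1 u) + x2 (d2 u)) = 0 := by
  have hN : r1 (d1 u) + r2 (d2 u) = u := by
    rw [← sub_eq_zero]
    refine h.level0 hm (sub_mem (h.mem_N hu) hu) ?_ ?_ ?_
    · rw [map_sub, h.AN hA, hA, sub_zero]
    · simp [h.dr11, h.dr12, h.d11, h12]
    · simp [h.dr21, h.dr22, h.d22, h.d21, h12]
  refine ⟨hN, ?_, ?_, ?_⟩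
  · rw [h.AB hu hA, hN]; module
  · simp [h.dx11, h.dx12, h.d11, h12]
  · simp [h.dx21, h.dx22, h.d22, h.d21, h12]

theorem CAR.exact1 (h : CAR r1 r2 d1 d2 x1 x2 p1 p2 G) {m : ℕ} (hm : 1 ≤ m) {u : V}
    (hu : u ∈ G m) (hA : opA r1 r2 p1 p2 u = 0) (h12 : d1 (d2 u) = 0) :
    ∃ y ∈ G (m + 1), opA r1 r2 p1 p2 y = u ∧ d1 y = 0 ∧ d2 y = 0 := by
  obtain ⟨-, a, b, c⟩ := h.level1 hm hu hA h12
  have hm' : (m : ℂ) + 1 ≠ 0 := by exact_mod_cast Nat.succ_ne_zero m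
  refine ⟨((m : ℂ) + 1)⁻¹ • (x1 (d1 u) + x2 (d2 u)), Submodule.smul_mem _ _ (h.mem_B hu), ?_, ?_, ?_⟩
  · rw [map_smul, a, smul_smul, inv_mul_cancel₀ hm', one_smul]
  · rw [map_smul, b, smul_zero]
  · rw [map_smul, c, smul_zero]

theorem CAR.exact2 (h : CAR r1 r2 d1 d2 x1 x2 p1 p2 G) {m : ℕ} (hm : 1 ≤ m) {u : V}
    (hu : u ∈ G m) (hA : opA r1 r2 p1 p2 u = 0) :
    ∃ y ∈ G (m + 1), opA r1 r2 p1 p2 y = u ∧ d1 (d2 y) = 0 := by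
  obtain ⟨u', hu'⟩ : ∃ u', u' = r1 (d1 u) + r2 (d2 u) - (2 : ℂ) • u := ⟨_, rfl⟩
  have hu'G : u' ∈ G m := hu' ▸ sub_mem (h.mem_N hu) (Submodule.smul_mem _ _ hu)
  have hu'A : opA r1 r2 p1 p2 u' = 0 := by
    rw [hu', map_sub, map_smul, h.AN hA, hA]; simp
  have hd : d1 (d2 u') = 0 := by
    rw [hu']
    simp only [map_add, map_sub, map_neg, map_smul, h.dr11, h.dr12, h.dr21, h.dr22, h.d11, h.d22,
      h.d21, map_zero]
    module
  obtain ⟨hN, a, b, c⟩ := h.level1 hm hu'G hu'A hd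
  have hm1 : (m : ℂ) + 1 ≠ 0 := by exact_mod_cast Nat.succ_ne_zero m
  have hm2 : (m : ℂ) + 2 ≠ 0 := by exact_mod_cast Nat.succ_ne_zero (m + 1)
  -- `u2 = u + u'` has `N u2 = 2 u2`
  have hNu : r1 (d1 u) + r2 (d2 u) = (2 : ℂ) • u + u' := by rw [hu']; module
  have a2 : opA r1 r2 p1 p2 (x1 (d1 (u + u')) + x2 (d2 (u + u'))) = ((m : ℂ) + 2) • (u + u') := by
    rw [h.AB (add_mem hu hu'G) (by rw [map_add, hA, hu'A, add_zero])]
    have : r1 (d1 (u + u')) + r2 (d2 (u + u'))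
      = (r1 (d1 u) + r2 (d2 u)) + (r1 (d1 u') + r2 (d2 u')) := by simp only [map_add]; abel
    rw [this, hN, hNu]; module
  refine ⟨((m : ℂ) + 2)⁻¹ • (x1 (d1 (u + u')) + x2 (d2 (u + u')))
    - ((m : ℂ) + 1)⁻¹ • (x1 (d1 u') + x2 (d2 u')), ?_, ?_, ?_⟩
  · exact sub_mem (Submodule.smul_mem _ _ (h.mem_B (add_mem hu hu'G)))
      (Submodule.smul_mem _ _ (h.mem_B hu'G))
  · rw [map_sub, map_smul, map_smul, a2, a, smul_smul, smul_smul, inv_mul_cancel₀ hm1,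
      inv_mul_cancel₀ hm2]; module
  · simp [h.dx11, h.dx12, h.dx21, h.dx22, h.d11, h.d22, h.d21]

variable {s1 s2 c1 c2 : V →ₗ[ℂ] V}

/-- `ker A₁ ∩ ker A₂ = im A₁A₂`. -/
theorem CAR.both (h : CAR r1 r2 d1 d2 x1 x2 p1 p2 G) (h' : CAR s1 s2 c1 c2 x1 x2 p1 p2 G)
    (hd1 : ∀ z, d1 (opA s1 s2 p1 p2 z) = - opA s1 s2 p1 p2 (d1 z))
    (hd2 : ∀ z, d2 (opA s1 s2 p1 p2 z) = - opA s1 s2 p1 p2 (d2 z))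
    (hs : ∀ z, opA s1 s2 p1 p2 (opA s1 s2 p1 p2 z) = 0)
    (hc : ∀ z, opA r1 r2 p1 p2 (opA s1 s2 p1 p2 z) = - opA s1 s2 p1 p2 (opA r1 r2 p1 p2 z))
    {m : ℕ} (hm : 1 ≤ m) {u : V}
    (hu : u ∈ G m) (hA : opA r1 r2 p1 p2 u = 0) (hA' : opA s1 s2 p1 p2 u = 0) :
    ∃ y ∈ G (m + 2), opA r1 r2 p1 p2 (opA s1 s2 p1 p2 y) = u := by
  obtain ⟨t0, t0G, t0A, t0d⟩ := h.exact2 hm hu hA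
  obtain ⟨t1, t1G, t1A, t1d, t1d'⟩ := h.exact1 hm (h'.mem_A t0G)
    (by rw [hc, t0A, hA', neg_zero]) (by rw [hd2, map_neg, hd1, t0d]; simp)
  have e1 : opA s1 s2 p1 p2 t1 = 0 := h.level0 hm (h'.mem_A t1G)
    (by rw [hc, t1A, hs, neg_zero]) (by rw [hd1, t1d]; simp) (by rw [hd2, t1d']; simp)
  obtain ⟨q1, q1G, q1A, -⟩ := h'.exact2 (by omega) t1G e1
  obtain ⟨q0, q0G, q0A, -⟩ := h'.exact2 (u := t0 + opA r1 r2 p1 p2 q1) (m := m + 1) (by omega)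
    (add_mem t0G (h.mem_A q1G))
    (by rw [map_add, ← t1A, ← q1A, hc]; simp)
  refine ⟨q0, q0G, ?_⟩
  rw [q0A, map_add, t0A]
  simp only [opA_apply, map_add, h.rp11, h.rp12, h.rp21, h.rp22, h.r11, h.r22, h.r21, h.p21]
  simp

theorem zigzag {A A' : V →ₗ[ℂ] V} {G : ℕ → Submodule ℂ V}
    (hG' : ∀ m, ∀ z ∈ G (m + 1), A' z ∈ G m)
    (hG : ∀ m, ∀ z ∈ G (m + 1), A z ∈ G m)
    (hAA : ∀ z, A (A z) = 0) (hs : ∀ z, A' (A' z) = 0) (hc : ∀ z, A (A' z) = - A' (A z))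
    {m : ℕ} (hex : ∀ z ∈ G m, A z = 0 → ∃ y ∈ G (m + 1), A y = z)
    (hboth : ∀ z ∈ G m, A z = 0 → A' z = 0 → ∃ y ∈ G (m + 2), A (A' y) = z) (b : ℕ) :
    ∀ z : ℕ → V, (∀ a, z a ∈ G m) → (∀ a, b + 1 < a → z a = 0) → A' (z 0) = 0 →
      (∀ a, A (z a) + A' (z (a + 1)) = 0) →
      ∃ y : ℕ → V, (∀ a, y a ∈ G (m + 1)) ∧ (∀ a, b < a → y a = 0) ∧ A' (y 0) = z 0 ∧
        ∀ a, A (y a) + A' (y (a + 1)) = z (a + 1) := by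
  induction b with
  | zero =>
    intro z zG z0 h0 h1
    obtain ⟨y, yG, yA⟩ := hex (z 1) (zG 1) (by have := h1 1; rwa [z0 2 (by omega), map_zero, add_zero] at this)
    obtain ⟨s, sG, sA⟩ := hboth (z 0 - A' y) (sub_mem (zG 0) (hG' _ _ yG))
      (by rw [map_sub, hc, yA, sub_neg_eq_add]; exact h1 0) (by rw [map_sub, h0, hs, sub_zero])
    refine ⟨fun a => if a = 0 then y - A s else 0, ?_, ?_, ?_, ?_⟩
    · intro a
      dsimp only
      split_ifs
      · exact sub_mem yG (hG _ _ sG)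
      · exact zero_mem _
    · intro a ha
      simp [show a ≠ 0 by omega]
    · have : A' (A s) = - A (A' s) := by rw [hc, neg_neg]
      simp [this, sA]
    · intro a
      rcases a with _ | a
      · simp [yA, hAA]
      · simp [z0 (a + 1 + 1) (by omega)]
  | succ b ih =>
    intro z zG z0 h0 h1
    obtain ⟨y, yG, yA⟩ := hex (z (b + 2)) (zG _) (by
      have := h1 (b + 2); rwa [z0 (b + 2 + 1) (by omega), map_zero, add_zero] at this)
    obtain ⟨y', y'G, y'0, y'1, y'2⟩ := ih
      (fun a => if a = b + 1 then z a - A' y else if a = b + 2 then 0 else z a) (by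
        intro a
        split_ifs
        · exact sub_mem (zG _) (hG' _ _ yG)
        · exact zero_mem _
        · exact zG _) (by
        intro a ha
        split_ifs
        · omega
        · rfl
        · exact z0 _ (by omega)) (by simpa using h0) (by
        intro a
        have := h1 a
        split_ifs with i1 i2 i3 i4 i5 <;> try omega
        · subst i1; rw [map_sub, hc, yA, map_zero, add_zero, sub_neg_eq_add]; exact this
        · have := h1 a; rw [z0 (a + 1) (by omega), map_zero] at *; simp
        · rw [map_sub, hs, sub_zero]; exact this)
    refine ⟨fun a => if a = b + 1 then y else y' a, ?_, ?_, ?_, ?_⟩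
    · intro a
      dsimp only
      split_ifs
      · exact yG
      · exact y'G _
    · intro a ha
      simp [show a ≠ b + 1 by omega, y'0 a (by omega)]
    · simpa using y'1
    · intro a
      have := y'2 a
      dsimp only at this ⊢
      split_ifs at this ⊢ with i1 i2 i3 i4 i5 <;> try omega
      · subst i1; rw [y'0 (b + 1 + 1) (by omega), map_zero, add_zero, yA]
      · rw [y'0 (a + 1) (by omega), map_zero, add_zero] at this
        rw [this]; simp
end abstractPart

/-- operators on the Clifford factor -/
def rT (f : Cl →ₗ[ℂ] Cl) : MCl →ₗ[ℂ] MCl := TensorProduct.map f LinearMap.id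
/-- operators on the polynomial factor -/
def lT (f : P4 →ₗ[ℂ] P4) : MCl →ₗ[ℂ] MCl := TensorProduct.map LinearMap.id f

theorem rT_tmul (f : Cl →ₗ[ℂ] Cl) (u : Cl) (p : P4) : rT f (u ⊗ₜ p) = f u ⊗ₜ p := rfl
theorem lT_tmul (f : P4 →ₗ[ℂ] P4) (u : Cl) (p : P4) : lT f (u ⊗ₜ p) = u ⊗ₜ f p := rfl

theorem rT_lT (f : Cl →ₗ[ℂ] Cl) (g : P4 →ₗ[ℂ] P4) (z : MCl) : rT f (lT g z) = lT g (rT f z) := by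
  induction z using TensorProduct.induction_on with
  | zero => simp only [map_zero]
  | tmul u p => rfl
  | add a b ha hb => simp only [map_add, ha, hb]

theorem rT_anti {f g : Cl →ₗ[ℂ] Cl} (c : ℂ) (h : ∀ u, f (g u) = c • u - g (f u)) (z : MCl) :
    rT f (rT g z) = c • z - rT g (rT f z) := by
  induction z using TensorProduct.induction_on with
  | zero => simp only [map_zero, smul_zero, sub_zero]
  | tmul u p => simp only [rT_tmul, h, TensorProduct.sub_tmul, TensorProduct.smul_tmul']
  | add a b ha hb => simp only [map_add, ha, hb, smul_add]; abel

theorem rT_anti1 {f g : Cl →ₗ[ℂ] Cl} (h : ∀ u, f (g u) = u - g (f u)) (z : MCl) :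
    rT f (rT g z) = z - rT g (rT f z) := by
  have := rT_anti (f := f) (g := g) 1 (fun u => by rw [h, one_smul]) z
  rwa [one_smul] at this

theorem rT_anti0 {f g : Cl →ₗ[ℂ] Cl} (h : ∀ u, f (g u) = - g (f u)) (z : MCl) :
    rT f (rT g z) = - rT g (rT f z) := by
  have := rT_anti (f := f) (g := g) 0 (fun u => by rw [h, zero_smul, zero_sub]) z
  rwa [zero_smul, zero_sub] at this

theorem rT_sq {f : Cl →ₗ[ℂ] Cl} (h : ∀ u, f (f u) = 0) (z : MCl) :
    rT f (rT f z) = 0 := by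
  induction z using TensorProduct.induction_on with
  | zero => simp only [map_zero]
  | tmul u p => simp only [rT_tmul, h, TensorProduct.zero_tmul]
  | add a b ha hb => simp only [map_add, ha, hb, add_zero]

theorem lT_lT {f g f' g' : P4 →ₗ[ℂ] P4} (h : ∀ u, f (g u) = f' (g' u)) (z : MCl) :
    lT f (lT g z) = lT f' (lT g' z) := by
  induction z using TensorProduct.induction_on with
  | zero => simp only [map_zero]
  | tmul u p => simp only [lT_tmul, h]
  | add a b ha hb => simp only [map_add, ha, hb]

theorem lT_comp {f g k : P4 →ₗ[ℂ] P4} (h : ∀ u, f (g u) = k u) (z : MCl) :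
    lT f (lT g z) = lT k z := by
  induction z using TensorProduct.induction_on with
  | zero => simp only [map_zero]
  | tmul u p => simp only [lT_tmul, h]
  | add a b ha hb => simp only [map_add, ha, hb]

theorem lT_lT1 {f g : P4 →ₗ[ℂ] P4} (h : ∀ u, f (g u) = u + g (f u)) (z : MCl) :
    lT f (lT g z) = z + lT g (lT f z) := by
  induction z using TensorProduct.induction_on with
  | zero => simp only [map_zero, add_zero]
  | tmul u p => simp only [lT_tmul, h, TensorProduct.tmul_add]
  | add a b ha hb => simp only [map_add, ha, hb]; abel

def Rw (w : Cl) : MCl →ₗ[ℂ] MCl := rT (LinearMap.mulRight ℂ w)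
def cD (d : Module.Dual (Polynomial ℂ) (Fin 4 → Polynomial ℂ)) : Cl →ₗ[ℂ] Cl :=
  ((CliffordAlgebra.contractRight (Q := Qf)).flip d).restrictScalars ℂ
def Dd (d : Module.Dual (Polynomial ℂ) (Fin 4 → Polynomial ℂ)) : MCl →ₗ[ℂ] MCl := rT (cD d)
def Xo (i : Fin 4) : MCl →ₗ[ℂ] MCl := lT (LinearMap.mulLeft ℂ (MvPolynomial.X i : P4))
def Po (i : Fin 4) : MCl →ₗ[ℂ] MCl := lT (pd i)
def Xm (a c : ℕ) : MCl →ₗ[ℂ] MCl :=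
  lT (LinearMap.mulLeft ℂ (MvPolynomial.X 2 ^ a * MvPolynomial.X 3 ^ c : P4))

/-- vectors and functionals -/
def vec (i j : Fin 4) (s t : ℂ) : Fin 4 → Polynomial ℂ :=
  Pi.single i (Polynomial.C s) + Pi.single j (Polynomial.C t)
def dual (i j : Fin 4) (s t : ℂ) : Module.Dual (Polynomial ℂ) (Fin 4 → Polynomial ℂ) :=
  Polynomial.C s • LinearMap.proj i + Polynomial.C t • LinearMap.proj j

theorem ι_vec (i j : Fin 4) (s t : ℂ) : CliffordAlgebra.ι Qf (vec i j s t) =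
    algebraMap ℂ Cl s * η i + algebraMap ℂ Cl t * η j := by
  have key : ∀ (i : Fin 4) (s : ℂ), CliffordAlgebra.ι Qf (Pi.single i (Polynomial.C s)) =
      algebraMap ℂ Cl s * η i := by
    intro i s
    have : (Pi.single i (Polynomial.C s) : Fin 4 → Polynomial ℂ)
        = Polynomial.C s • Pi.single i 1 := by
      rw [← Pi.single_smul]; simp
    rw [this, map_smul, Algebra.smul_def, η]
    congr 1
  rw [vec, map_add, key, key]

theorem w11_eq : w11 = CliffordAlgebra.ι Qf (vec 1 0 1 Complex.I) := by
  rw [ι_vec, map_one, one_mul]; rfl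
theorem w22_eq : w22 = CliffordAlgebra.ι Qf (vec 1 0 1 (-Complex.I)) := by
  rw [ι_vec, map_one, one_mul, map_neg, neg_mul, ← sub_eq_add_neg]; rfl
theorem w12_eq : w12 = CliffordAlgebra.ι Qf (vec 3 2 (-1) Complex.I) := by
  rw [ι_vec, map_neg, map_one, neg_one_mul]; rfl
theorem w21_eq : w21 = CliffordAlgebra.ι Qf (vec 3 2 1 Complex.I) := by
  rw [ι_vec, map_one, one_mul]; rfl

theorem ι_anti (a b : Fin 4 → Polynomial ℂ) (c : Polynomial ℂ)
    (h : QuadraticMap.polar Qf a b = c) :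
    CliffordAlgebra.ι Qf a * CliffordAlgebra.ι Qf b + CliffordAlgebra.ι Qf b * CliffordAlgebra.ι Qf a
      = algebraMap _ _ c := by
  rw [CliffordAlgebra.ι_mul_ι_add_swap, h]

theorem Qf_apply (a : Fin 4 → Polynomial ℂ) : Qf a = Polynomial.X *
    (a 0 * a 0 + a 1 * a 1 + a 2 * a 2 + a 3 * a 3) := by
  simp [Qf, QuadraticMap.weightedSumSquares_apply, Fin.sum_univ_four]; ring

theorem polar_Qf (a b : Fin 4 → Polynomial ℂ) : QuadraticMap.polar Qf a b = 2 * Polynomial.X *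
    (a 0 * b 0 + a 1 * b 1 + a 2 * b 2 + a 3 * b 3) := by
  simp only [QuadraticMap.polar, Qf_apply, Pi.add_apply]; ring

theorem CI_sq : (Polynomial.C Complex.I : Polynomial ℂ) * Polynomial.C Complex.I = -1 := by
  rw [← Polynomial.C_mul, Complex.I_mul_I]; simp

theorem anti0 {a b : Fin 4 → Polynomial ℂ}
    (h : a 0 * b 0 + a 1 * b 1 + a 2 * b 2 + a 3 * b 3 = 0) :
    CliffordAlgebra.ι Qf a * CliffordAlgebra.ι Qf b = -
      (CliffordAlgebra.ι Qf b * CliffordAlgebra.ι Qf a) := by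
  have := ι_anti a b 0 (by rw [polar_Qf, h, mul_zero])
  rw [map_zero] at this
  exact eq_neg_of_add_eq_zero_left this

theorem sq0 {a : Fin 4 → Polynomial ℂ}
    (h : a 0 * a 0 + a 1 * a 1 + a 2 * a 2 + a 3 * a 3 = 0) :
    CliffordAlgebra.ι Qf a * CliffordAlgebra.ι Qf a = 0 := by
  rw [CliffordAlgebra.ι_sq_scalar, Qf_apply, h, mul_zero, map_zero]

theorem w11_sq : w11 * w11 = 0 := by
  rw [w11_eq]; apply sq0; simp [vec, CI_sq]
theorem w22_sq : w22 * w22 = 0 := by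
  rw [w22_eq]; apply sq0; simp [vec, CI_sq]
theorem w12_sq : w12 * w12 = 0 := by
  rw [w12_eq]; apply sq0; simp [vec, CI_sq]
theorem w21_sq : w21 * w21 = 0 := by
  rw [w21_eq]; apply sq0; simp [vec, CI_sq]
theorem w11_w21 : w11 * w21 = - (w21 * w11) := by
  rw [w11_eq, w21_eq]; apply anti0; simp [vec]
theorem w12_w22 : w12 * w22 = - (w22 * w12) := by
  rw [w12_eq, w22_eq]; apply anti0; simp [vec]
theorem w11_w12 : w11 * w12 = - (w12 * w11) := by
  rw [w11_eq, w12_eq]; apply anti0; simp [vec]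
theorem w21_w22 : w21 * w22 = - (w22 * w21) := by
  rw [w21_eq, w22_eq]; apply anti0; simp [vec]
theorem w_mixed : w11 * w22 + w22 * w11 + (w12 * w21 + w21 * w12) = 0 := by
  rw [w11_eq, w22_eq, w12_eq, w21_eq, ι_anti _ _ _ rfl, ι_anti _ _ _ rfl, ← map_add, polar_Qf,
    polar_Qf]
  refine (congrArg _ ?_).trans (map_zero _)
  simp [vec, CI_sq]
  ring

theorem Rw_tmul (w u : Cl) (p : P4) : Rw w (u ⊗ₜ p) = (u * w) ⊗ₜ p := rfl

theorem Rw_sq {w : Cl} (h : w * w = 0) (z : MCl) : Rw w (Rw w z) = 0 :=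
  rT_sq (fun u => by simp [mul_assoc, h]) z
theorem Rw_anti {w w' : Cl} (h : w * w' = - (w' * w)) (z : MCl) :
    Rw w (Rw w' z) = - Rw w' (Rw w z) :=
  rT_anti0 (fun u => by simp [mul_assoc, h]) z
theorem Rw_mixed (z : MCl) : Rw w11 (Rw w22 z) + Rw w22 (Rw w11 z) +
    (Rw w12 (Rw w21 z) + Rw w21 (Rw w12 z)) = 0 := by
  induction z using TensorProduct.induction_on with
  | zero => simp only [map_zero, add_zero]
  | tmul u p =>
    simp only [Rw_tmul, ← TensorProduct.add_tmul, mul_assoc, ← mul_add]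
    rw [add_comm (w22 * w11), add_comm (w21 * w12), w_mixed, mul_zero, TensorProduct.zero_tmul]
  | add a b ha hb =>
    have := congrArg₂ (· + ·) ha hb
    simp only [add_zero] at this
    rw [← this]
    simp only [map_add]
    abel

theorem cD_mul (d : Module.Dual (Polynomial ℂ) (Fin 4 → Polynomial ℂ)) (a : Fin 4 → Polynomial ℂ)
    (u : Cl) : cD d (u * CliffordAlgebra.ι Qf a) = d a • u - cD d u * CliffordAlgebra.ι Qf a :=
  CliffordAlgebra.contractRight_mul_ι d a u

theorem Dd_sq (d) (z : MCl) : Dd d (Dd d z) = 0 :=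
  rT_sq (fun u => CliffordAlgebra.contractRight_contractRight d u) z
theorem Dd_anti (d d') (z : MCl) : Dd d (Dd d' z) = - Dd d' (Dd d z) :=
  rT_anti0 (fun u => CliffordAlgebra.contractRight_comm d' d u) z
theorem Dd_Rw1 {d} {a} (h : d a = 1) (z : MCl) : Dd d (Rw (CliffordAlgebra.ι Qf a) z) =
    z - Rw (CliffordAlgebra.ι Qf a) (Dd d z) :=
  rT_anti1 (fun u => by
    rw [LinearMap.mulRight_apply, LinearMap.mulRight_apply, cD_mul, h, one_smul]) z
theorem Dd_Rw0 {d} {a} (h : d a = 0) (z : MCl) : Dd d (Rw (CliffordAlgebra.ι Qf a) z) =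
    - Rw (CliffordAlgebra.ι Qf a) (Dd d z) :=
  rT_anti0 (fun u => by
    rw [LinearMap.mulRight_apply, LinearMap.mulRight_apply, cD_mul, h, zero_smul, zero_sub]) z

def d11 := dual 1 0 (1/2) (-Complex.I/2)
def d22 := dual 1 0 (1/2) (Complex.I/2)
def d21 := dual 3 2 (1/2) (-Complex.I/2)
def d12 := dual 3 2 (-1/2) (-Complex.I/2)

theorem dual_same (i j : Fin 4) (hij : i ≠ j) (s t s' t' c : ℂ) (h : s * s' + t * t' = c) :
    dual i j s t (vec i j s' t') = Polynomial.C c := by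
  subst h
  simp [dual, vec, hij, hij.symm]

theorem d11_w11 (z : MCl) : Dd d11 (Rw w11 z) = z - Rw w11 (Dd d11 z) := by
  rw [w11_eq]; apply Dd_Rw1
  rw [d11, dual_same _ _ (by decide) _ _ _ _ 1 (by linear_combination (-1/2) * Complex.I_mul_I)]; simp
theorem d22_w22 (z : MCl) : Dd d22 (Rw w22 z) = z - Rw w22 (Dd d22 z) := by
  rw [w22_eq]; apply Dd_Rw1
  rw [d22, dual_same _ _ (by decide) _ _ _ _ 1 (by linear_combination (-1/2) * Complex.I_mul_I)]; simp
theorem d12_w12 (z : MCl) : Dd d12 (Rw w12 z) = z - Rw w12 (Dd d12 z) := by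
  rw [w12_eq]; apply Dd_Rw1
  rw [d12, dual_same _ _ (by decide) _ _ _ _ 1 (by linear_combination (-1/2) * Complex.I_mul_I)]; simp
theorem d21_w21 (z : MCl) : Dd d21 (Rw w21 z) = z - Rw w21 (Dd d21 z) := by
  rw [w21_eq]; apply Dd_Rw1
  rw [d21, dual_same _ _ (by decide) _ _ _ _ 1 (by linear_combination (-1/2) * Complex.I_mul_I)]; simp
theorem d11_w22 (z : MCl) : Dd d11 (Rw w22 z) = - Rw w22 (Dd d11 z) := by
  rw [w22_eq]; apply Dd_Rw0
  rw [d11, dual_same _ _ (by decide) _ _ _ _ 0 (by linear_combination (1/2) * Complex.I_mul_I)]; simp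
theorem d21_w12 (z : MCl) : Dd d21 (Rw w12 z) = - Rw w12 (Dd d21 z) := by
  rw [w12_eq]; apply Dd_Rw0
  rw [d21, dual_same _ _ (by decide) _ _ _ _ 0 (by linear_combination (-1/2) * Complex.I_mul_I)]; simp
theorem d11_w21 (z : MCl) : Dd d11 (Rw w21 z) = - Rw w21 (Dd d11 z) := by
  rw [w21_eq]; apply Dd_Rw0; simp [d11, dual, vec]
theorem d21_w11 (z : MCl) : Dd d21 (Rw w11 z) = - Rw w11 (Dd d21 z) := by
  rw [w11_eq]; apply Dd_Rw0; simp [d21, dual, vec]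
theorem d12_w22 (z : MCl) : Dd d12 (Rw w22 z) = - Rw w22 (Dd d12 z) := by
  rw [w22_eq]; apply Dd_Rw0; simp [d12, dual, vec]
theorem d22_w12 (z : MCl) : Dd d22 (Rw w12 z) = - Rw w12 (Dd d22 z) := by
  rw [w12_eq]; apply Dd_Rw0; simp [d22, dual, vec]
theorem d11_w12 (z : MCl) : Dd d11 (Rw w12 z) = - Rw w12 (Dd d11 z) := by
  rw [w12_eq]; apply Dd_Rw0; simp [d11, dual, vec]
theorem d21_w22 (z : MCl) : Dd d21 (Rw w22 z) = - Rw w22 (Dd d21 z) := by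
  rw [w22_eq]; apply Dd_Rw0; simp [d21, dual, vec]

theorem Po_Xo_same (i : Fin 4) (z : MCl) : Po i (Xo i z) = z + Xo i (Po i z) :=
  lT_lT1 (fun p => by simp [pd, mul_comm, add_comm]) z
theorem Po_Xo_ne {i j : Fin 4} (h : i ≠ j) (z : MCl) : Po i (Xo j z) = Xo j (Po i z) :=
  lT_lT (fun p => by simp [pd, MvPolynomial.pderiv_X_of_ne h.symm]) z
theorem Po_comm (i j : Fin 4) (z : MCl) : Po i (Po j z) = Po j (Po i z) :=
  lT_lT (fun p => by
    change MvPolynomial.pderiv i (MvPolynomial.pderiv j p) =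
      MvPolynomial.pderiv j (MvPolynomial.pderiv i p)
    have : ⁅(MvPolynomial.pderiv i : Derivation ℂ P4 P4), (MvPolynomial.pderiv j : Derivation ℂ P4 P4)⁆ = 0 := by
      apply MvPolynomial.derivation_ext
      intro k
      rw [Derivation.commutator_apply]
      simp only [MvPolynomial.pderiv_X, Pi.single_apply]
      split_ifs <;> simp
    have := congrArg (fun D : Derivation ℂ P4 P4 => D p) this
    rw [← sub_eq_zero]
    simpa [Derivation.commutator_apply] using this) z

theorem MD_ind {m b : ℕ} (T : MCl →ₗ[ℂ] MCl) (S : Submodule ℂ MCl)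
    (h : ∀ (u : Cl) (p : P4), MvPolynomial.IsWeightedHomogeneous wx p m →
      MvPolynomial.IsWeightedHomogeneous wv p b → T (u ⊗ₜ p) ∈ S) :
    ∀ z ∈ MD m b, T z ∈ S := by
  have : MD m b ≤ S.comap T := by
    rw [MD, Submodule.span_le]
    rintro _ ⟨u, p, hx, hv, rfl⟩
    exact h u p hx hv
  exact this

theorem MD_mem {m b : ℕ} (u : Cl) {p : P4} (h1 : MvPolynomial.IsWeightedHomogeneous wx p m)
    (h2 : MvPolynomial.IsWeightedHomogeneous wv p b) : (u ⊗ₜ p : MCl) ∈ MD m b :=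
  Submodule.subset_span ⟨u, p, h1, h2, rfl⟩

theorem MD_rT (f) (b m : ℕ) : ∀ z ∈ MD m b, rT f z ∈ MD m b :=
  MD_ind _ _ fun _ _ h1 h2 => MD_mem _ h1 h2

theorem MD_Xo (i : Fin 4) {m b m' b' : ℕ} (h1 : wx i + m = m') (h2 : wv i + b = b') :
    ∀ z ∈ MD m b, Xo i z ∈ MD m' b' :=
  MD_ind _ _ fun _ p hx hv => MD_mem _
    (h1 ▸ (MvPolynomial.isWeightedHomogeneous_X ℂ wx i).mul hx)
    (h2 ▸ (MvPolynomial.isWeightedHomogeneous_X ℂ wv i).mul hv)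

theorem MD_Po (i : Fin 4) {m b m' b' : ℕ} (h1 : m' + wx i = m) (h2 : b' + wv i = b) :
    ∀ z ∈ MD m b, Po i z ∈ MD m' b' :=
  MD_ind _ _ fun _ p hx hv => MD_mem _ (hx.pderiv h1) (hv.pderiv h2)

theorem MD_euler (m b : ℕ) : ∀ z ∈ MD m b, Xo 0 (Po 0 z) + Xo 1 (Po 1 z) = (m : ℂ) • z := by
  have : ∀ z ∈ MD m b, (Xo 0 ∘ₗ Po 0 + Xo 1 ∘ₗ Po 1 - (m : ℂ) • (LinearMap.id : MCl →ₗ[ℂ] MCl) : MCl →ₗ[ℂ] MCl) z ∈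
      (⊥ : Submodule ℂ MCl) := by
    refine MD_ind _ _ fun u p hx hv => ?_
    have := hx.sum_weight_X_mul_pderiv
    simp [Fin.sum_univ_four, wx] at this
    rw [Submodule.mem_bot]
    change u ⊗ₜ[ℂ] (MvPolynomial.X 0 * MvPolynomial.pderiv 0 p) +
      u ⊗ₜ[ℂ] (MvPolynomial.X 1 * MvPolynomial.pderiv 1 p) - (m : ℂ) • u ⊗ₜ[ℂ] p = 0
    rw [← TensorProduct.tmul_add, this, ← TensorProduct.tmul_smul, sub_eq_zero]
    congr 1
    rw [MvPolynomial.smul_eq_C_mul]; simp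
  intro z hz
  have := this z hz
  rw [Submodule.mem_bot] at this
  exact sub_eq_zero.1 this

theorem CAR_mk (w w' : Cl) (d d') (b : ℕ) (h1 : w * w = 0) (h2 : w' * w' = 0)
    (h3 : w * w' = - (w' * w)) (e1 : ∀ z, Dd d (Rw w z) = z - Rw w (Dd d z))
    (e2 : ∀ z, Dd d (Rw w' z) = - Rw w' (Dd d z))
    (e3 : ∀ z, Dd d' (Rw w z) = - Rw w (Dd d' z))
    (e4 : ∀ z, Dd d' (Rw w' z) = z - Rw w' (Dd d' z)) :
    CAR (Rw w) (Rw w') (Dd d) (Dd d') (Xo 0) (Xo 1) (Po 0) (Po 1) (fun m => MD m b) where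
  r11 := Rw_sq h1
  r22 := Rw_sq h2
  r21 z := by rw [Rw_anti h3, neg_neg]
  d11 := Dd_sq _
  d22 := Dd_sq _
  d21 := Dd_anti _ _
  dr11 := e1
  dr12 := e2
  dr21 := e3
  dr22 := e4
  px11 := Po_Xo_same _
  px12 := Po_Xo_ne (by decide)
  px21 := Po_Xo_ne (by decide)
  px22 := Po_Xo_same _
  p21 := Po_comm _ _
  rx11 := rT_lT _ _
  rx12 := rT_lT _ _
  rx21 := rT_lT _ _
  rx22 := rT_lT _ _
  dx11 := rT_lT _ _
  dx12 := rT_lT _ _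
  dx21 := rT_lT _ _
  dx22 := rT_lT _ _
  rp11 := rT_lT _ _
  rp12 := rT_lT _ _
  rp21 := rT_lT _ _
  rp22 := rT_lT _ _
  dp11 := rT_lT _ _
  dp12 := rT_lT _ _
  dp21 := rT_lT _ _
  dp22 := rT_lT _ _
  euler m := MD_euler m b
  Gr1 := MD_rT _ b
  Gr2 := MD_rT _ b
  Gd1 := MD_rT _ b
  Gd2 := MD_rT _ b
  Gx1 m := MD_Xo 0 (by simp [wx, add_comm]) (by simp [wv])
  Gx2 m := MD_Xo 1 (by simp [wx, add_comm]) (by simp [wv])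
  Gp1 m := MD_Po 0 (by simp [wx]) (by simp [wv])
  Gp2 m := MD_Po 1 (by simp [wx]) (by simp [wv])

theorem car1 (b : ℕ) : CAR (Rw w11) (Rw w21) (Dd d11) (Dd d21) (Xo 0) (Xo 1) (Po 0) (Po 1)
    (fun m => MD m b) :=
  CAR_mk _ _ _ _ b w11_sq w21_sq w11_w21 d11_w11 d11_w21 d21_w11 d21_w21
theorem car2 (b : ℕ) : CAR (Rw w12) (Rw w22) (Dd d12) (Dd d22) (Xo 0) (Xo 1) (Po 0) (Po 1)
    (fun m => MD m b) :=
  CAR_mk _ _ _ _ b w12_sq w22_sq w12_w22 d12_w12 d12_w22 d22_w12 d22_w22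

def A1 : MCl →ₗ[ℂ] MCl := opA (Rw w11) (Rw w21) (Po 0) (Po 1)
def A2 : MCl →ₗ[ℂ] MCl := opA (Rw w12) (Rw w22) (Po 0) (Po 1)

theorem Rw_Po (w i z) : Rw w (Po i z) = Po i (Rw w z) := rT_lT _ _ z

theorem A1_A1 (z : MCl) : A1 (A1 z) = 0 := by
  simp only [A1, opA_apply, map_add, Rw_Po, Rw_sq w11_sq, Rw_sq w21_sq, Rw_anti w11_w21,
    Po_comm 1 0, map_neg, map_zero]
  abel
theorem A2_A2 (z : MCl) : A2 (A2 z) = 0 := by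
  simp only [A2, opA_apply, map_add, Rw_Po, Rw_sq w12_sq, Rw_sq w22_sq, Rw_anti w12_w22,
    Po_comm 1 0, map_neg, map_zero]
  abel
theorem A1_A2 (z : MCl) : A1 (A2 z) = - A2 (A1 z) := by
  have h := congrArg (fun t => Po 0 (Po 1 t)) (Rw_mixed z)
  simp only [map_add, map_zero] at h
  rw [← add_eq_zero_iff_eq_neg, ← h]
  simp only [A1, A2, opA_apply, map_add, Rw_Po, Rw_anti w11_w12, Rw_anti w21_w22,
    Po_comm 1 0, map_neg, map_zero]
  abel
theorem D11_A2 (z : MCl) : Dd d11 (A2 z) = - A2 (Dd d11 z) := by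
  have e : ∀ i z, Dd d11 (Po i z) = Po i (Dd d11 z) := fun i z => rT_lT _ _ z
  simp only [A2, opA_apply, map_add, Rw_Po, e, d11_w12, d11_w22, map_neg]
  abel
theorem D21_A2 (z : MCl) : Dd d21 (A2 z) = - A2 (Dd d21 z) := by
  have e : ∀ i z, Dd d21 (Po i z) = Po i (Dd d21 z) := fun i z => rT_lT _ _ z
  simp only [A2, opA_apply, map_add, Rw_Po, e, d21_w12, d21_w22, map_neg]
  abel

theorem A1_mem (b m : ℕ) : ∀ z ∈ MD (m + 1) b, A1 z ∈ MD m b := fun _ hz => (car1 b).mem_A hz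
theorem A2_mem (b m : ℕ) : ∀ z ∈ MD (m + 1) b, A2 z ∈ MD m b := fun _ hz => (car2 b).mem_A hz

theorem zz {m : ℕ} (hm : 1 ≤ m) (b : ℕ) (z : ℕ → MCl) (zG : ∀ a, z a ∈ MD m 0)
    (z0 : ∀ a, b + 1 < a → z a = 0) (h0 : A2 (z 0) = 0)
    (h1 : ∀ a, A1 (z a) + A2 (z (a + 1)) = 0) :
      ∃ y : ℕ → MCl, (∀ a, y a ∈ MD (m + 1) 0) ∧ (∀ a, b < a → y a = 0) ∧ A2 (y 0) = z 0 ∧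
        ∀ a, A1 (y a) + A2 (y (a + 1)) = z (a + 1) :=
  zigzag (G := fun m => MD m 0) (A2_mem 0) (A1_mem 0) A1_A1 A2_A2 A1_A2
    (fun z hz hA => by
      obtain ⟨y, hy, e, -⟩ := (car1 0).exact2 hm hz hA
      exact ⟨y, hy, e⟩)
    (fun z hz hA hA' => (car1 0).both (car2 0) D11_A2 D21_A2 A2_A2 A1_A2 hm hz hA hA')
    b z zG z0 h0 h1

theorem nabla_eq (z : MCl) : nablaD z = Xo 2 (A1 z) + Xo 3 (A2 z) := by
  induction z using TensorProduct.induction_on with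
  | zero => simp only [map_zero, add_zero]
  | tmul u p =>
    simp only [A1, A2, opA_apply, map_add]
    change _ ⊗ₜ[ℂ] _ + _ ⊗ₜ[ℂ] _ + _ ⊗ₜ[ℂ] _ + _ ⊗ₜ[ℂ] _ =
      _ ⊗ₜ[ℂ] _ + _ ⊗ₜ[ℂ] _ + (_ ⊗ₜ[ℂ] _ + _ ⊗ₜ[ℂ] _)
    rw [add_assoc]
    rfl
  | add a b ha hb => simp only [map_add, ha, hb]; abel

theorem Xo2_Xm (a c : ℕ) (z : MCl) : Xo 2 (Xm a c z) = Xm (a + 1) c z :=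
  lT_comp (fun p => by simp only [LinearMap.mulLeft_apply]; ring) z
theorem Xo3_Xm (a c : ℕ) (z : MCl) : Xo 3 (Xm a c z) = Xm a (c + 1) z :=
  lT_comp (fun p => by simp only [LinearMap.mulLeft_apply]; ring) z

theorem Po_Xm (i : Fin 4) (h2 : i ≠ 2) (h3 : i ≠ 3) (a c : ℕ) (z : MCl) :
    Po i (Xm a c z) = Xm a c (Po i z) :=
  lT_lT (fun p => by
    simp [pd, MvPolynomial.pderiv_X_of_ne h2.symm, MvPolynomial.pderiv_X_of_ne h3.symm]) z
theorem Rw_Xm (w a c z) : Rw w (Xm a c z) = Xm a c (Rw w z) := rT_lT _ _ z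

theorem A1_Xm (a c : ℕ) (z : MCl) : A1 (Xm a c z) = Xm a c (A1 z) := by
  simp only [A1, opA_apply, Po_Xm 0 (by decide) (by decide), Po_Xm 1 (by decide) (by decide),
    Rw_Xm, map_add]
theorem A2_Xm (a c : ℕ) (z : MCl) : A2 (Xm a c z) = Xm a c (A2 z) := by
  simp only [A2, opA_apply, Po_Xm 0 (by decide) (by decide), Po_Xm 1 (by decide) (by decide),
    Rw_Xm, map_add]

/-- coefficients of `∇` of a `v`-polynomial -/
def tt (y : ℕ → MCl) : ℕ → MCl
  | 0 => A2 (y 0)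
  | a + 1 => A1 (y a) + A2 (y (a + 1))

/-- the element `∑ v₁^a v₂^(c-a) y_a` -/
def ev (c : ℕ) (y : ℕ → MCl) : MCl := ∑ a ∈ Finset.range (c + 1), Xm a (c - a) (y a)

theorem nabla_ev (c : ℕ) (y : ℕ → MCl) (hy : ∀ a, c < a → y a = 0) :
    nablaD (ev c y) = ev (c + 1) (tt y) := by
  have e1 : nablaD (ev c y) = ∑ a ∈ Finset.range (c + 1), Xm (a + 1) (c - a) (A1 (y a)) +
      ∑ a ∈ Finset.range (c + 1), Xm a (c + 1 - a) (A2 (y a)) := by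
    rw [ev, map_sum, ← Finset.sum_add_distrib]
    refine Finset.sum_congr rfl fun a ha => ?_
    rw [Finset.mem_range] at ha
    rw [nabla_eq, A1_Xm, A2_Xm, Xo2_Xm, Xo3_Xm, show c - a + 1 = c + 1 - a by omega]
  have e2 : ∑ a ∈ Finset.range (c + 1), Xm a (c + 1 - a) (A2 (y a)) =
      ∑ a ∈ Finset.range (c + 2), Xm a (c + 1 - a) (A2 (y a)) := by
    rw [Finset.sum_range_succ _ (c + 1), hy (c + 1) (by omega), map_zero, map_zero, add_zero]
  rw [e1, e2, ev, Finset.sum_range_succ' _ (c + 1), Finset.sum_range_succ' _ (c + 1), ← add_assoc,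
    ← Finset.sum_add_distrib]
  congr 1
  refine Finset.sum_congr rfl fun a ha => ?_
  rw [tt, map_add, show c + 1 - (a + 1) = c - a by omega]

theorem Xm_inj (a c : ℕ) : Function.Injective (Xm a c) := by
  have h : Function.Injective
      (LinearMap.mulLeft ℂ (MvPolynomial.X 2 ^ a * MvPolynomial.X 3 ^ c : P4)) := by
    intro p q hpq
    refine mul_left_cancel₀ ?_ hpq
    exact mul_ne_zero (pow_ne_zero _ (MvPolynomial.X_ne_zero _))
      (pow_ne_zero _ (MvPolynomial.X_ne_zero _))
  exact Module.Flat.lTensor_preserves_injective_linearMap (M := Cl) _ h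

def w2 : Fin 4 → ℕ := ![0, 0, 1, 0]

theorem weight4 (w : Fin 4 → ℕ) (d : Fin 4 →₀ ℕ) : Finsupp.weight w d =
    d 0 * w 0 + d 1 * w 1 + d 2 * w 2 + d 3 * w 3 := by
  rw [Finsupp.weight_apply, Finsupp.sum_fintype _ _ (by simp), Fin.sum_univ_four]
  simp only [smul_eq_mul]

theorem w2_of_wv {p : P4} (h : MvPolynomial.IsWeightedHomogeneous wv p 0) :
    MvPolynomial.IsWeightedHomogeneous w2 p 0 := by
  intro d hd
  have := h hd
  rw [weight4] at this ⊢
  simp [wv, w2] at this ⊢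
  omega

theorem comp_Xm (k a c m : ℕ) : ∀ z ∈ MD m 0,
    lT (MvPolynomial.weightedHomogeneousComponent w2 k) (Xm a c z) =
      if a = k then Xm a c z else 0 := by
  intro z hz
  have : (lT (MvPolynomial.weightedHomogeneousComponent w2 k) ∘ₗ Xm a c -
      (if a = k then Xm a c else 0) : MCl →ₗ[ℂ] MCl) z ∈ (⊥ : Submodule ℂ MCl) := by
    refine MD_ind _ _ (fun u p hx hv => ?_) z hz
    rw [Submodule.mem_bot, LinearMap.sub_apply, LinearMap.comp_apply, sub_eq_zero]
    have hp : MvPolynomial.IsWeightedHomogeneous w2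
        (MvPolynomial.X 2 ^ a * MvPolynomial.X 3 ^ c * p : P4) a := by
      have := (((MvPolynomial.isWeightedHomogeneous_X ℂ w2 2).pow a).mul
        ((MvPolynomial.isWeightedHomogeneous_X ℂ w2 3).pow c)).mul (w2_of_wv hv)
      simpa [w2] using this
    rw [Xm, lT_tmul, lT_tmul, LinearMap.mulLeft_apply]
    split_ifs with h
    · subst h
      rw [hp.weightedHomogeneousComponent_same]; rfl
    · rw [hp.weightedHomogeneousComponent_ne _ (Ne.symm h), TensorProduct.tmul_zero]; rfl
  rw [Submodule.mem_bot, LinearMap.sub_apply, LinearMap.comp_apply, sub_eq_zero] at this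
  rw [this]
  split_ifs <;> rfl

theorem ev_inj {c m : ℕ} {y : ℕ → MCl} (hy : ∀ a, y a ∈ MD m 0) (h : ev c y = 0) :
    ∀ a, a ≤ c → y a = 0 := by
  intro k hk
  have := congrArg (lT (MvPolynomial.weightedHomogeneousComponent w2 k)) h
  rw [ev, map_sum, map_zero, Finset.sum_congr rfl (fun a _ => comp_Xm k a (c - a) m _ (hy a)),
    Finset.sum_ite_eq' , if_pos (Finset.mem_range.2 (by omega))] at this
  exact Xm_inj _ _ (this.trans (map_zero _).symm)

theorem exists_ev {m c : ℕ} : ∀ z ∈ MD m c, ∃ y : ℕ → MCl, (∀ a, y a ∈ MD m 0) ∧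
    (∀ a, c < a → y a = 0) ∧ z = ev c y := by
  let S : Submodule ℂ MCl :=
    { carrier := {z | ∃ y : ℕ → MCl, (∀ a, y a ∈ MD m 0) ∧ (∀ a, c < a → y a = 0) ∧ z = ev c y}
      zero_mem' := ⟨fun _ => 0, fun _ => zero_mem _, fun _ _ => rfl, by simp [ev]⟩
      add_mem' := by
        rintro _ _ ⟨y, h1, h2, rfl⟩ ⟨y', h1', h2', rfl⟩
        refine ⟨fun a => y a + y' a, fun a => add_mem (h1 a) (h1' a), fun a ha => ?_, ?_⟩
        · dsimp only
          rw [h2 a ha, h2' a ha, add_zero]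
        · simp only [ev, map_add, Finset.sum_add_distrib]
      smul_mem' := by
        rintro t _ ⟨y, h1, h2, rfl⟩
        refine ⟨fun a => t • y a, fun a => Submodule.smul_mem _ _ (h1 a), fun a ha => ?_, ?_⟩
        · dsimp only
          rw [h2 a ha, smul_zero]
        · simp only [ev, map_smul, Finset.smul_sum] }
  suffices h : ∀ z ∈ MD m c, (LinearMap.id : MCl →ₗ[ℂ] MCl) z ∈ S from h
  refine MD_ind _ _ fun u p hx hv => ?_
  change u ⊗ₜ[ℂ] p ∈ S
  rw [p.as_sum, TensorProduct.tmul_sum]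
  refine sum_mem fun d hd => ?_
  rw [MvPolynomial.mem_support_iff] at hd
  have ex := hx hd
  have ev' := hv hd
  rw [weight4] at ex ev'
  simp [wv, wx] at ex ev'
  let d' : Fin 4 →₀ ℕ := Finsupp.single 0 (d 0) + Finsupp.single 1 (d 1)
  have hd' : d = (Finsupp.single 2 (d 2) + Finsupp.single 3 (d 3)) + d' := by
    ext i; fin_cases i <;> simp [d', Finsupp.single_apply]
  refine ⟨fun a => if a = d 2 then u ⊗ₜ[ℂ] MvPolynomial.monomial d' (MvPolynomial.coeff d p) else 0,
    fun a => ?_, fun a ha => ?_, ?_⟩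
  · dsimp only
    split_ifs
    · apply MD_mem
      · apply MvPolynomial.isWeightedHomogeneous_monomial
        rw [weight4]; simp [d', wx]; exact ex
      · apply MvPolynomial.isWeightedHomogeneous_monomial
        rw [weight4]; simp [d', wv]
    · exact zero_mem _
  · exact if_neg (by omega)
  · rw [ev, Finset.sum_eq_single (d 2)]
    · rw [if_pos rfl, Xm, lT_tmul, LinearMap.mulLeft_apply, show c - d 2 = d 3 by omega]
      congr 1
      rw [MvPolynomial.X_pow_eq_monomial, MvPolynomial.X_pow_eq_monomial,
        MvPolynomial.monomial_mul, MvPolynomial.monomial_mul, ← hd']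
      simp
    · intro a _ ha
      rw [if_neg ha, map_zero]
    · intro h
      exact absurd (Finset.mem_range.2 (by omega)) h

theorem Xm_mem {m : ℕ} (a c b : ℕ) (h : a + c = b) : ∀ z ∈ MD m 0, Xm a c z ∈ MD m b :=
  MD_ind _ _ fun _ p hx hv => MD_mem _
    (by
      have := (((MvPolynomial.isWeightedHomogeneous_X ℂ wx 2).pow a).mul
        ((MvPolynomial.isWeightedHomogeneous_X ℂ wx 3).pow c)).mul hx
      simpa [wx, mul_assoc] using this)
    (by
      have := (((MvPolynomial.isWeightedHomogeneous_X ℂ wv 2).pow a).mul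
        ((MvPolynomial.isWeightedHomogeneous_X ℂ wv 3).pow c)).mul hv
      simpa [wv, h, mul_assoc] using this)

theorem Xo_comm (i j : Fin 4) (z : MCl) : Xo i (Xo j z) = Xo j (Xo i z) :=
  lT_lT (fun p => by simp only [LinearMap.mulLeft_apply]; ring) z
theorem A1_Xo (i : Fin 4) (h0 : 0 ≠ i) (h1 : 1 ≠ i) (z : MCl) : A1 (Xo i z) = Xo i (A1 z) := by
  have e : ∀ w z, Rw w (Xo i z) = Xo i (Rw w z) := fun w z => rT_lT _ _ z
  simp only [A1, opA_apply, Po_Xo_ne h0, Po_Xo_ne h1, e, map_add]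
theorem A2_Xo (i : Fin 4) (h0 : 0 ≠ i) (h1 : 1 ≠ i) (z : MCl) : A2 (Xo i z) = Xo i (A2 z) := by
  have e : ∀ w z, Rw w (Xo i z) = Xo i (Rw w z) := fun w z => rT_lT _ _ z
  simp only [A2, opA_apply, Po_Xo_ne h0, Po_Xo_ne h1, e, map_add]

theorem nabla_nabla (z : MCl) : nablaD (nablaD z) = 0 := by
  simp only [nabla_eq, map_add, A1_Xo 2 (by decide) (by decide), A1_Xo 3 (by decide) (by decide),
    A2_Xo 2 (by decide) (by decide), A2_Xo 3 (by decide) (by decide), A1_A1, A2_A2, A1_A2,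
    Xo_comm 3 2, map_zero, map_neg]
  abel

/-- for `m, b ≥ 1`,
`ker(∇ : M_D^{(m,b)} → M_D^{(m−1,b+1)}) = ∇(M_D^{(m+1,b−1)})`: the quadrant-D
complexes are exact at every interior point. -/
theorem quadrantD_exact (m b : ℕ) (hm : 1 ≤ m) (hb : 1 ≤ b) :
    MD m b ⊓ LinearMap.ker nablaD = Submodule.map nablaD (MD (m + 1) (b - 1)) := by
  obtain ⟨c, rfl⟩ : ∃ c, b = c + 1 := ⟨b - 1, by omega⟩
  obtain ⟨k, rfl⟩ : ∃ k, m = k + 1 := ⟨m - 1, by omega⟩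
  rw [Nat.add_sub_cancel]
  apply le_antisymm
  · rintro z ⟨hz, hker⟩
    rw [SetLike.mem_coe, LinearMap.mem_ker] at hker
    obtain ⟨y, yG, y0, rfl⟩ := exists_ev z hz
    rw [nabla_ev _ _ y0] at hker
    have htG : ∀ a, tt y a ∈ MD k 0 := by
      intro a
      cases a with
      | zero => exact A2_mem _ _ _ (yG _)
      | succ a => exact add_mem (A1_mem _ _ _ (yG _)) (A2_mem _ _ _ (yG _))
    have ht := ev_inj htG hker
    obtain ⟨x, xG, x0, e0, e1⟩ := zz hm c y yG y0 (ht 0 (by omega)) (by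
      intro a
      by_cases ha : a + 1 ≤ c + 1 + 1
      · exact ht (a + 1) ha
      · rw [y0 a (by omega), y0 (a + 1) (by omega), map_zero, map_zero, add_zero])
    refine ⟨ev c x, ?_, ?_⟩
    · exact sum_mem fun a ha => Xm_mem _ _ _ (by rw [Finset.mem_range] at ha; omega) _ (xG a)
    · rw [nabla_ev _ _ x0]
      congr 1
      funext a
      cases a with
      | zero => exact e0
      | succ a => exact e1 a
  · rintro _ ⟨z, hz, rfl⟩
    refine ⟨?_, ?_⟩
    · rw [nabla_eq]
      exact add_mem (MD_Xo 2 (by simp [wx]) (by simp [wv, add_comm]) _ (A1_mem _ _ _ hz))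
        (MD_Xo 3 (by simp [wx]) (by simp [wv, add_comm]) _ (A2_mem _ _ _ hz))
    · rw [SetLike.mem_coe, LinearMap.mem_ker]
      exact nabla_nabla z

end
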